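/- Let k, ℓ, m ≥ 0 and n be integers, let W = p₂δᵏq₂δ^ℓ r₂δᵐs₂δⁿt₂ and W₁ = p₁δ^{k+ℓ}q₁r₁s₁δ^{m+n}t₁. Then: (i) every reduced computation of S₂ starting at W is semiproper; (ii) CS₂(W, W) consists of the single trivial computation, i.e. no nontrivial reduced computation leads from W back to W; (iii) S₂(W, p₁) holds if and only if ℓ = m, in which case CS₂(W, p₁) consists of exactly one computation, and its last word is W₁. -/

import Mathlib

/-! ### S-machines -/

/-- A group word over tape letters `T` and state letters `S`. -/
abbrev GWord (T S : Type) := List ((T ⊕ S) × Bool)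

/-- An `S`-rule `[U₁ → V₁, …, U_m → V_m]`, listed in left-to-right order. -/
structure SRule (T S : Type) where
  subs : List (GWord T S × GWord T S)
deriving DecidableEq

/-- The formal inverse of a group word. -/
def invWord {T S : Type} (w : GWord T S) : GWord T S := (w.map fun p => (p.1, !p.2)).reverse

/-- The inverse of an `S`-rule: if `τ = [Uᵢ → xᵢ Vᵢ' yᵢ]` where `Vᵢ'` starts and ends with
state letters, then `τ⁻¹ = [Vᵢ' → xᵢ⁻¹ Uᵢ yᵢ⁻¹]`. -/
def ruleInv {T S : Type} (r : SRule T S) : SRule T S :=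
  ⟨r.subs.map fun UV =>
    let x := UV.2.takeWhile fun p => p.1.isLeft
    let y := (UV.2.reverse.takeWhile fun p => p.1.isLeft).reverse
    ((UV.2.drop x.length).take (UV.2.length - x.length - y.length),
      invWord x ++ UV.1 ++ invWord y)⟩

/-- The hardware of an `S`-machine: `n` sectors of tape letters and `n + 1` components
of state letters. -/
structure SHardware (T S : Type) where
  n : ℕ
  Y : Fin n → Set T
  Q : Fin (n + 1) → Set S

/-- Lifting a word over tape letters to a group word. -/
def liftT {T S : Type} (u : List (T × Bool)) : GWord T S := u.map fun p => (Sum.inl p.1, p.2)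

/-- A word is freely reduced (irreducible): no adjacent pair `x x⁻¹` or `x⁻¹ x`. -/
def FreeReduced {β : Type} (u : List (β × Bool)) : Prop :=
  u.Chain' fun p q => ¬(p.1 = q.1 ∧ q.2 = !p.2)

/-- The admissible word `q₀ u₀ q₁ u₁ ⋯ u_{n-1} q_n`. -/
def SHardware.assemble {T S : Type} (H : SHardware T S) (q : Fin (H.n + 1) → S)
    (u : Fin H.n → List (T × Bool)) : GWord T S :=
  (((List.finRange H.n).map fun i => ((Sum.inr (q i.castSucc), true) :: liftT (u i))).flatten)
    ++ [(Sum.inr (q (Fin.last H.n)), true)]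

/-- A word is admissible for the hardware `H` if it lies in
`Q₁ F(Y₁) Q₂ F(Y₂) ⋯ F(Y_n) Q_{n+1}`. -/
def SHardware.Admissible {T S : Type} (H : SHardware T S) (w : GWord T S) : Prop :=
  ∃ (q : Fin (H.n + 1) → S) (u : Fin H.n → List (T × Bool)),
    (∀ i, q i ∈ H.Q i) ∧ (∀ i, (∀ p ∈ u i, p.1 ∈ H.Y i) ∧ FreeReduced (u i)) ∧
    w = H.assemble q u

/-- `Splice subs w z`: `w = x₀ U₁ x₁ U₂ ⋯ U_m x_m` and `z = x₀ V₁ x₁ V₂ ⋯ V_m x_m`,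
where `subs = [(U₁,V₁),…,(U_m,V_m)]` (simultaneous replacement, in order). -/
def Splice {T S : Type} : List (GWord T S × GWord T S) → GWord T S → GWord T S → Prop
  | [], w, z => w = z
  | UV :: rest, w, z =>
      ∃ x w₁ z₁, w = x ++ UV.1 ++ w₁ ∧ z = x ++ UV.2 ++ z₁ ∧ Splice rest w₁ z₁

/-- Applying an `S`-rule: replace the `Uᵢ` simultaneously by the `Vᵢ` and freely reduce. -/
def ApplyRule {T S : Type} (r : SRule T S) (w w' : GWord T S) : Prop :=
  ∃ z, Splice r.subs w z ∧ FreeGroup.Red z w' ∧ FreeReduced w'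

/-- An `S`-machine: a hardware together with a (finite, symmetric) list of rules. -/
structure SMachine (T S : Type) where
  H : SHardware T S
  rules : List (SRule T S)
  symm : ∀ r ∈ rules, ruleInv r ∈ rules

/-- `ws` is a computation of the `S`-machine `M` with history `h`: a nonempty sequence of
admissible words, each obtained from the previous one by applying the corresponding rule
of the history. -/
def IsComputation {T S : Type} (M : SMachine T S) (ws : List (GWord T S))
    (h : List (SRule T S)) : Prop :=
  ws ≠ [] ∧ h.length + 1 = ws.length ∧ (∀ w ∈ ws, M.H.Admissible w) ∧
  ∀ i, i < h.length →
    h.getD i ⟨[]⟩ ∈ M.rules ∧ ApplyRule (h.getD i ⟨[]⟩) (ws.getD i []) (ws.getD (i + 1) [])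

/-- A history is reduced: two mutually inverse rules are never applied next to
each other. -/
def ReducedHist {T S : Type} (h : List (SRule T S)) : Prop :=
  ∀ i, i + 1 < h.length → h.getD (i + 1) ⟨[]⟩ ≠ ruleInv (h.getD i ⟨[]⟩)

/-- The first word of a computation. -/
def firstW {T S : Type} (ws : List (GWord T S)) : GWord T S := ws.headI

/-- The last word `τC` of a computation. -/
def lastW {T S : Type} (ws : List (GWord T S)) : GWord T S := ws.getLastD []

/-- The computation `(ws, h)` connects `W` and `W'`. -/
def Connects {T S : Type} (M : SMachine T S) (ws : List (GWord T S)) (h : List (SRule T S))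
    (W W' : GWord T S) : Prop :=
  IsComputation M ws h ∧ firstW ws = W ∧ lastW ws = W'

/-- The number of occurrences of the negative letter `a⁻¹` in a word. -/
def negCount {T S : Type} [DecidableEq T] (a : T) (w : GWord T S) : ℕ :=
  w.countP fun p => (match p.1 with | Sum.inl t => decide (t = a) | Sum.inr _ => false) && !p.2

/-- A computation is semiproper: negative letters inserted during the computation
(in excess of those present in the first word) never disappear at a later stage. -/
def Semiproper {T S : Type} [DecidableEq T] (ws : List (GWord T S)) : Prop :=
  ∀ a : T, ∀ i j : ℕ, i ≤ j → j < ws.length →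
    negCount a (ws.getD i []) - negCount a (ws.getD 0 []) ≤ negCount a (ws.getD j [])

/-- A word is positive: it contains no negative letters. -/
def PositiveW {T S : Type} (w : GWord T S) : Prop := ∀ p ∈ w, p.2 = true

/-- Membership in `CS(W, v₁, …, v_k)`: `(ws, h)` is a reduced computation starting at `W`
whose last word contains each of the words in `vs` as a subword. -/
def InCS {T S : Type} (M : SMachine T S) (ws : List (GWord T S)) (h : List (SRule T S))
    (W : GWord T S) (vs : List (GWord T S)) : Prop :=
  IsComputation M ws h ∧ ReducedHist h ∧ firstW ws = W ∧ ∀ v ∈ vs, v <:+: lastW ws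

/-- The area of a computation: the sum of the lengths of its words. -/
def SArea {T S : Type} (ws : List (GWord T S)) : ℕ := (ws.map List.length).sum

/-! ### The `S`-machine `S₂` -/

/-- The state letters of `S₂`. -/
inductive St : Type
  | p1 | p2 | q1 | q2 | r1 | r2 | s1 | s2 | t1 | t2
deriving DecidableEq

open St

/-- A (positive) state letter, as a letter of a group word. -/
def st (x : St) : (Unit ⊕ St) × Bool := (Sum.inr x, true)

/-- The tape letter `δ` or its inverse. -/
def dl (b : Bool) : (Unit ⊕ St) × Bool := (Sum.inl (), b)

/-- The word `δ^k` (for an integer `k`). -/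
def dpow (k : ℤ) : GWord Unit St :=
  if 0 ≤ k then List.replicate k.toNat (dl true) else List.replicate (-k).toNat (dl false)

/-- The admissible word `p δ^a q δ^b r δ^c s δ^d t`. -/
def wform (p q r s t : St) (a b c d : ℤ) : GWord Unit St :=
  [st p] ++ dpow a ++ [st q] ++ dpow b ++ [st r] ++ dpow c ++ [st s] ++ dpow d ++ [st t]

/-- The hardware of `S₂`. -/
def H2 : SHardware Unit St where
  n := 4
  Y := fun _ => Set.univ
  Q := ![{p1, p2}, {q1, q2}, {r1, r2}, {s1, s2}, {t1, t2}]

/-- Rule (1): `[q₂ → δ q₂ δ⁻¹, s₂ → δ⁻¹ s₂ δ]`. -/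
def rule1 : SRule Unit St :=
  ⟨[([st q2], [dl true, st q2, dl false]), ([st s2], [dl false, st s2, dl true])]⟩

/-- Rule (2): `[q₂r₂s₂ → q₁r₁s₁, p₂ → p₁, t₂ → t₁]`. -/
def rule2 : SRule Unit St :=
  ⟨[([st p2], [st p1]), ([st q2, st r2, st s2], [st q1, st r1, st s1]),
    ([st t2], [st t1])]⟩

/-- The `S`-machine `S₂`. -/
def M2 : SMachine Unit St where
  H := H2
  rules := [rule1, rule2, ruleInv rule1, ruleInv rule2]
  symm := by decide

/-- `W = p₂ δᵏ q₂ δ^ℓ r₂ δᵐ s₂ δⁿ t₂`. -/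
def Wst (k l m : ℕ) (n : ℤ) : GWord Unit St := wform p2 q2 r2 s2 t2 k l m n

/-- `W₁ = p₁ δ^{k+ℓ} q₁ r₁ s₁ δ^{m+n} t₁`. -/
def Wone (k l m : ℕ) (n : ℤ) : GWord Unit St :=
  wform p1 q1 r1 s1 t1 ((k : ℤ) + l) 0 0 ((m : ℤ) + n)

theorem mem_dpow {x : (Unit ⊕ St) × Bool} {k : ℤ} (h : x ∈ dpow k) :
    x = dl true ∨ x = dl false := by
  unfold dpow at h
  split at h
  · exact Or.inl (List.eq_of_mem_replicate h)
  · exact Or.inr (List.eq_of_mem_replicate h)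

@[simp] theorem inr_notMem_dpow (x : St) (b : Bool) (k : ℤ) :
    ((Sum.inr x, b) : (Unit ⊕ St) × Bool) ∉ dpow k := by
  intro h
  rcases mem_dpow h with h | h <;> simp [dl] at h

@[simp] theorem st_notMem_dpow (x : St) (k : ℤ) : st x ∉ dpow k := inr_notMem_dpow x true k

@[simp] theorem st_inj {x y : St} : st x = st y ↔ x = y := by simp [st]

theorem dpow_zero : dpow 0 = [] := by simp [dpow]

theorem dpow_eq_nil {k : ℤ} : dpow k = [] ↔ k = 0 := by
  unfold dpow
  split <;> simp <;> omega

theorem countP_dpow (k : ℤ) :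
    (dpow k).countP (fun p => !p.2) = (-k).toNat := by
  unfold dpow
  split
  · simp [List.countP_replicate, dl]; omega
  · simp [List.countP_replicate, dl]

theorem dpow_injective : Function.Injective dpow := by
  intro a b h
  have h₁ := congrArg List.length h
  have h₂ := congrArg (List.countP fun p => !p.2) h
  rw [countP_dpow, countP_dpow] at h₂
  unfold dpow at h₁
  split at h₁ <;> split at h₁ <;> simp at h₁ <;> omega

theorem wform_eq (p q r s t : St) (a b c d : ℤ) :
    wform p q r s t a b c d =
      st p :: (dpow a ++ st q :: (dpow b ++ st r :: (dpow c ++ st s :: (dpow d ++ [st t])))) := by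
  simp [wform]

theorem eq_of_wform_infix {a b c d a' b' c' d' : ℤ}
    (h : wform p2 q2 r2 s2 t2 a b c d <:+: wform p2 q2 r2 s2 t2 a' b' c' d') : a = a' := by
  obtain ⟨x, y, h⟩ := h
  simp only [wform_eq, List.append_assoc, List.cons_append] at h
  obtain ⟨-, -, h'⟩ := (List.append_cons_inj_of_notMem (x₁ := []) (by simp) (by simp)).1 h.symm
  obtain ⟨h', -⟩ := (List.append_cons_inj_of_notMem (by simp) (by simp)).1 h'
  exact dpow_injective h'.symm

/-! ### Free reduction of the words in question -/

theorem freeReduced_iff {β : Type} {u : List (β × Bool)} :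
    FreeReduced u ↔ FreeGroup.IsReduced u := by
  unfold FreeReduced FreeGroup.IsReduced List.Chain'
  have : (fun p q : β × Bool => ¬(p.1 = q.1 ∧ q.2 = !p.2)) =
      fun p q => p.1 = q.1 → p.2 = q.2 := by
    funext p q
    cases p.2 <;> cases q.2 <;> simp
  rw [this]

theorem isReduced_dpow_append {k : ℤ} {x : St} {v : GWord Unit St}
    (h : FreeGroup.IsReduced (st x :: v)) : FreeGroup.IsReduced (dpow k ++ st x :: v) := by
  refine List.isChain_append.2 ⟨?_, h, ?_⟩
  · unfold dpow
    split <;> exact List.isChain_replicate_of_rel _ (by simp)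
  · intro y hy z hz hyz
    simp only [List.head?_cons, Option.mem_def, Option.some.injEq] at hz
    subst hz
    rcases mem_dpow (List.mem_of_mem_getLast? hy) with rfl | rfl <;> simp [dl, st] at hyz

theorem isReduced_cons_st {x : St} {v : GWord Unit St} (h : FreeGroup.IsReduced v)
    (hv : ∀ y, (Sum.inr y, false) ∉ v) : FreeGroup.IsReduced (st x :: v) := by
  refine List.isChain_cons.2 ⟨?_, h⟩
  rintro ⟨y, b⟩ hy hxy
  have := List.mem_of_mem_head? hy
  cases b
  · simp only [st] at hxy
    subst hxy
    exact absurd this (hv x)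
  · rfl

theorem freeReduced_wform (p q r s t : St) (a b c d : ℤ) :
    FreeReduced (wform p q r s t a b c d) := by
  rw [freeReduced_iff, wform_eq]
  repeat first
    | exact List.isChain_singleton _
    | apply isReduced_dpow_append
    | (refine isReduced_cons_st ?_ (by simp [st]))

theorem red_and_freeReduced_iff {α : Type} [DecidableEq α] {z w w' : List (α × Bool)}
    (hw : FreeReduced w) (h : FreeGroup.mk z = FreeGroup.mk w) :
    FreeGroup.Red z w' ∧ FreeReduced w' ↔ w' = w := by
  rw [freeReduced_iff] at *
  have hz : FreeGroup.reduce z = w := (FreeGroup.reduce.sound h).trans hw.reduce_eq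
  constructor
  · rintro ⟨hr, hw'⟩
    rw [← hw'.reduce_eq, ← hz]
    exact (FreeGroup.reduce.eq_of_red hr).symm
  · rintro rfl
    exact ⟨hz ▸ FreeGroup.reduce.red, hw⟩

theorem mk_dl (b : Bool) :
    FreeGroup.mk [dl b] = FreeGroup.of (Sum.inl () : Unit ⊕ St) ^ (if b then 1 else -1 : ℤ) := by
  cases b
  · simp [dl, FreeGroup.of, FreeGroup.inv_mk, FreeGroup.invRev]
  · simp [dl, FreeGroup.of]

theorem mk_dpow (k : ℤ) :
    FreeGroup.mk (dpow k) = FreeGroup.of (Sum.inl () : Unit ⊕ St) ^ k := by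
  have key (n : ℕ) (b : Bool) :
      FreeGroup.mk (List.replicate n (dl b)) = FreeGroup.mk [dl b] ^ n := by
    induction n with
    | zero => rfl
    | succ n ih => rw [pow_succ', ← ih, FreeGroup.mul_mk]; rfl
  unfold dpow
  split
  · rw [key, mk_dl]
    simp only [if_true, zpow_one]
    rw [← zpow_natCast]; congr 1; omega
  · rw [key, mk_dl]
    simp only [Bool.false_eq_true, if_false]
    rw [← zpow_natCast, ← zpow_mul]; congr 1; omega

theorem mk_wform (p q r s t : St) (a b c d : ℤ) :
    FreeGroup.mk (wform p q r s t a b c d) =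
      FreeGroup.mk [st p] * FreeGroup.of (Sum.inl ()) ^ a * FreeGroup.mk [st q] *
      FreeGroup.of (Sum.inl ()) ^ b * FreeGroup.mk [st r] * FreeGroup.of (Sum.inl ()) ^ c *
      FreeGroup.mk [st s] * FreeGroup.of (Sum.inl ()) ^ d * FreeGroup.mk [st t] := by
  simp only [wform, ← FreeGroup.mul_mk, mk_dpow]

/-! ### Single rule applications -/

/-- The rule (1), for `true`, or its inverse, for `false`. -/
def shift : Bool → SRule Unit St
  | true => rule1
  | false => ruleInv rule1

/-- The exponent by which `shift` moves the letters `δ`. -/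
def sgn : Bool → ℤ
  | true => 1
  | false => -1

theorem shift_eq (e : Bool) :
    shift e = ⟨[([st q2], [dl e, st q2, dl !e]), ([st s2], [dl !e, st s2, dl e])]⟩ := by
  cases e <;> decide

theorem ruleInv_shift (e : Bool) : ruleInv (shift e) = shift (!e) := by
  cases e <;> decide

theorem ruleInv_rule2 : ruleInv rule2 =
    ⟨[([st p1], [st p2]), ([st q1, st r1, st s1], [st q2, st r2, st s2]),
      ([st t1], [st t2])]⟩ := by
  decide

theorem applyRule_shift_iff {e : Bool} {a b c d : ℤ} {w : GWord Unit St} :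
    ApplyRule (shift e) (wform p2 q2 r2 s2 t2 a b c d) w ↔
      w = wform p2 q2 r2 s2 t2 (a + sgn e) (b - sgn e) (c - sgn e) (d + sgn e) := by
  set z : GWord Unit St := [st p2] ++ dpow a ++ [dl e] ++ [st q2] ++ [dl !e] ++ dpow b ++ [st r2] ++
    dpow c ++ [dl !e] ++ [st s2] ++ [dl e] ++ dpow d ++ [st t2] with hz
  have hs (z' : GWord Unit St) :
      Splice (shift e).subs (wform p2 q2 r2 s2 t2 a b c d) z' ↔ z' = z := by
    rw [shift_eq]
    constructor
    · rintro ⟨x, w₁, z₁, h₁, rfl, x', w₂, z₂, h₂, rfl, rfl⟩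
      simp only [wform_eq, List.append_assoc, List.singleton_append] at h₁
      rw [← List.cons_append, List.append_cons_inj_of_notMem (by simp) (by simp)] at h₁
      obtain ⟨rfl, -, rfl⟩ := h₁
      simp only [List.append_assoc, List.singleton_append] at h₂
      rw [← List.cons_append, ← List.append_assoc,
        List.append_cons_inj_of_notMem (by simp) (by simp)] at h₂
      obtain ⟨rfl, -, rfl⟩ := h₂
      simp [hz]
    · rintro rfl
      exact ⟨[st p2] ++ dpow a, dpow b ++ [st r2] ++ dpow c ++ [st s2] ++ dpow d ++ [st t2], _,
        by simp [wform], by simp [hz]; rfl, dpow b ++ [st r2] ++ dpow c, dpow d ++ [st t2], _,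
        by simp, by simp, rfl⟩
  have hr := red_and_freeReduced_iff (z := z) (w' := w)
    (freeReduced_wform p2 q2 r2 s2 t2 (a + sgn e) (b - sgn e) (c - sgn e) (d + sgn e)) (by
      simp only [hz, mk_wform, ← FreeGroup.mul_mk, mk_dpow, mk_dl]
      cases e <;> simp only [sgn, zpow_add, zpow_sub, zpow_neg, zpow_one, Bool.not_true,
        Bool.not_false, if_true, Bool.false_eq_true, if_false, inv_inv] <;> group)
  rw [← hr]
  simp only [ApplyRule, hs, exists_eq_left]

theorem splice_swap_iff {p q r s t p' q' r' s' t' : St} {a b c d : ℤ} {z : GWord Unit St}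
    (hp : p ∉ [q, r, s, t]) (hq : q ∉ [r, s, t]) :
    Splice [([st p], [st p']), ([st q, st r, st s], [st q', st r', st s']), ([st t], [st t'])]
      (wform p q r s t a b c d) z ↔ b = 0 ∧ c = 0 ∧ z = wform p' q' r' s' t' a 0 0 d := by
  simp only [List.mem_cons, List.not_mem_nil, or_false, not_or] at hp hq
  constructor
  · rintro ⟨x, w₁, z₁, h₁, rfl, x', w₂, z₂, h₂, rfl, x'', w₃, z₃, h₃, rfl, rfl⟩
    simp only [wform_eq, List.append_assoc, List.singleton_append] at h₁
    rw [← List.nil_append (st p :: _),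
      List.append_cons_inj_of_notMem (by simp) (by simp [hp])] at h₁
    obtain ⟨rfl, -, rfl⟩ := h₁
    simp only [List.append_assoc, List.cons_append, List.nil_append] at h₂
    rw [List.append_cons_inj_of_notMem (by simp) (by simp [hq])] at h₂
    obtain ⟨rfl, -, h₂⟩ := h₂
    have hb : b = 0 := by
      rw [← dpow_eq_nil]
      rcases hk : dpow b with _ | ⟨y, u⟩
      · rfl
      · have hy : y ∈ dpow b := by simp [hk]
        simp only [hk, List.cons_append, List.cons.injEq] at h₂
        exact absurd (h₂.1 ▸ hy) (by simp)
    subst hb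
    simp only [dpow_zero, List.nil_append, List.cons.injEq, true_and] at h₂
    have hc : c = 0 := by
      rw [← dpow_eq_nil]
      rcases hk : dpow c with _ | ⟨y, u⟩
      · rfl
      · have hy : y ∈ dpow c := by simp [hk]
        simp only [hk, List.cons_append, List.cons.injEq] at h₂
        exact absurd (h₂.1 ▸ hy) (by simp)
    subst hc
    simp only [dpow_zero, List.nil_append, List.cons.injEq, true_and] at h₂
    rw [← h₂, List.append_assoc, List.singleton_append,
      List.append_cons_inj_of_notMem (by simp) (by simp)] at h₃
    obtain ⟨rfl, -, rfl⟩ := h₃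
    simp [wform, dpow_zero]
  · rintro ⟨rfl, rfl, rfl⟩
    exact ⟨[], dpow a ++ [st q, st r, st s] ++ dpow d ++ [st t], _, by simp [wform, dpow_zero],
      by simp [wform]; rfl, dpow a, dpow d ++ [st t], _, by simp, by simp; rfl,
      dpow d, [], _, by simp, by simp, rfl⟩

theorem applyRule_rule2_iff {a b c d : ℤ} {w : GWord Unit St} :
    ApplyRule rule2 (wform p2 q2 r2 s2 t2 a b c d) w ↔
      b = 0 ∧ c = 0 ∧ w = wform p1 q1 r1 s1 t1 a 0 0 d := by
  simp only [ApplyRule, rule2, splice_swap_iff (by decide : p2 ∉ [q2, r2, s2, t2])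
    (by decide : q2 ∉ [r2, s2, t2]), and_assoc,
    exists_and_left, exists_eq_left]
  rw [red_and_freeReduced_iff (freeReduced_wform _ _ _ _ _ _ _ _ _) rfl]

theorem applyRule_ruleInv_rule2_iff {a b c d : ℤ} {w : GWord Unit St} :
    ApplyRule (ruleInv rule2) (wform p1 q1 r1 s1 t1 a b c d) w ↔
      b = 0 ∧ c = 0 ∧ w = wform p2 q2 r2 s2 t2 a 0 0 d := by
  simp only [ApplyRule, ruleInv_rule2, splice_swap_iff (by decide : p1 ∉ [q1, r1, s1, t1])
    (by decide : q1 ∉ [r1, s1, t1]), and_assoc,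
    exists_and_left, exists_eq_left]
  rw [red_and_freeReduced_iff (freeReduced_wform _ _ _ _ _ _ _ _ _) rfl]

theorem mem_of_splice_cons {T S : Type} {x : (T ⊕ S) × Bool} {U V : GWord T S}
    {l : List (GWord T S × GWord T S)} {w z : GWord T S} (h : Splice ((U, V) :: l) w z)
    (hx : x ∈ U) : x ∈ w := by
  obtain ⟨y, w₁, z₁, rfl, -, -⟩ := h
  simp [hx]

theorem not_applyRule_ruleInv_rule2 {a b c d : ℤ} {w : GWord Unit St} :
    ¬ApplyRule (ruleInv rule2) (wform p2 q2 r2 s2 t2 a b c d) w := by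
  rw [ruleInv_rule2]
  rintro ⟨z, hz, -⟩
  have := mem_of_splice_cons hz (List.mem_singleton_self _)
  simp [wform_eq] at this

theorem not_applyRule_rule2 {a b c d : ℤ} {w : GWord Unit St} :
    ¬ApplyRule rule2 (wform p1 q1 r1 s1 t1 a b c d) w := by
  rintro ⟨z, hz, -⟩
  have := mem_of_splice_cons hz (List.mem_singleton_self _)
  simp [wform_eq] at this

theorem not_applyRule_shift {e : Bool} {a b c d : ℤ} {w : GWord Unit St} :
    ¬ApplyRule (shift e) (wform p1 q1 r1 s1 t1 a b c d) w := by
  rw [shift_eq]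
  rintro ⟨z, hz, -⟩
  have := mem_of_splice_cons hz (List.mem_singleton_self _)
  simp [wform_eq] at this

theorem mem_rules {r : SRule Unit St} :
    r ∈ M2.rules ↔ (∃ e, r = shift e) ∨ r = rule2 ∨ r = ruleInv rule2 := by
  simp only [M2, List.mem_cons, List.not_mem_nil, or_false, Bool.exists_bool, shift]
  tauto

theorem admissible_wform {p q r s t : St} (hp : p = p1 ∨ p = p2) (hq : q = q1 ∨ q = q2)
    (hr : r = r1 ∨ r = r2) (hs : s = s1 ∨ s = s2) (ht : t = t1 ∨ t = t2) (a b c d : ℤ) :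
    M2.H.Admissible (wform p q r s t a b c d) := by
  have lift (k : ℤ) : ∃ u : List (Unit × Bool), FreeReduced u ∧ liftT u = dpow k := by
    refine ⟨(dpow k).map fun x => ((), x.2), ?_, ?_⟩
    · rw [freeReduced_iff]
      unfold dpow
      split <;> rw [List.map_replicate] <;> exact List.isChain_replicate_of_rel _ (by simp)
    · unfold liftT dpow
      split <;> simp [dl]
  obtain ⟨u₁, h₁, e₁⟩ := lift a
  obtain ⟨u₂, h₂, e₂⟩ := lift b
  obtain ⟨u₃, h₃, e₃⟩ := lift c
  obtain ⟨u₄, h₄, e₄⟩ := lift d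
  refine ⟨(![p, q, r, s, t] : Fin 5 → St), (![u₁, u₂, u₃, u₄] : Fin 4 → _), ?_, ?_, ?_⟩
  · change ∀ i : Fin 5, _
    intro i
    fin_cases i
    exacts [hp, hq, hr, hs, ht]
  · change ∀ i : Fin 4, _
    intro i
    refine ⟨fun _ _ => trivial, ?_⟩
    fin_cases i
    exacts [h₁, h₂, h₃, h₄]
  · rw [wform_eq, ← e₁, ← e₂, ← e₃, ← e₄]
    simp [SHardware.assemble, M2, H2, List.finRange_succ, st, Fin.last]

/-! ### Computations, built from the end -/

section Concat

variable {T S : Type}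

theorem lastW_concat (ws : List (GWord T S)) (w : GWord T S) : lastW (ws ++ [w]) = w := by
  simp [lastW]

theorem isComputation_nil_iff {M : SMachine T S} {ws : List (GWord T S)} :
    IsComputation M ws [] ↔ ∃ w, ws = [w] ∧ M.H.Admissible w := by
  constructor
  · rintro ⟨-, hl, ha, -⟩
    obtain ⟨w, rfl⟩ := List.length_eq_one_iff.1 (hl.symm.trans (by simp))
    exact ⟨w, rfl, ha w (by simp)⟩
  · rintro ⟨w, rfl, h⟩
    exact ⟨by simp, by simp, by simpa using h, by simp⟩

theorem isComputation_concat_iff {M : SMachine T S} {ws : List (GWord T S)}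
    {h : List (SRule T S)} {r : SRule T S} :
    IsComputation M ws (h ++ [r]) ↔ ∃ ws' w, ws = ws' ++ [w] ∧ IsComputation M ws' h ∧
      M.H.Admissible w ∧ r ∈ M.rules ∧ ApplyRule r (lastW ws') w := by
  have last {ws' : List (GWord T S)} (hl : h.length + 1 = ws'.length) :
      lastW ws' = ws'.getD h.length [] := by
    rw [lastW, List.getLastD_eq_getLast?, List.getLast?_eq_getElem?, List.getD_eq_getElem?_getD,
      ← hl]
    rfl
  constructor
  · rintro ⟨hne, hl, ha, hs⟩
    obtain ⟨ws', w, rfl⟩ : ∃ ws' w, ws = ws' ++ [w] :=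
      ⟨_, _, (List.dropLast_append_getLast hne).symm⟩
    have hl' : h.length + 1 = ws'.length := by simpa using hl
    refine ⟨ws', w, rfl, ⟨?_, hl', fun w hw => ha w (by simp [hw]), fun i hi => ?_⟩,
      ha w (by simp), ?_⟩
    · rintro rfl
      simp at hl'
    · have := hs i (by simp; omega)
      rwa [List.getD_append _ _ _ _ hi, List.getD_append _ _ _ _ (by omega),
        List.getD_append _ _ _ _ (by omega)] at this
    · have := hs h.length (by simp)
      rw [List.getD_append_right _ _ _ _ le_rfl, List.getD_append _ _ _ _ (by omega),
        List.getD_append_right _ _ _ _ (by omega)] at this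
      rw [last hl']
      simpa [hl'] using this
  · rintro ⟨ws', w, rfl, ⟨hne, hl, ha, hs⟩, hw, hr, hrw⟩
    refine ⟨by simp, by simp [hl], ?_, fun i hi => ?_⟩
    · intro v hv
      rcases List.mem_append.1 hv with hv | hv
      · exact ha v hv
      · rwa [List.mem_singleton.1 hv]
    · rcases (show i ≤ h.length by simpa using Nat.lt_succ_iff.1 (by simpa using hi)).lt_or_eq
        with hi | rfl
      · rw [List.getD_append _ _ _ _ hi, List.getD_append _ _ _ _ (by omega),
          List.getD_append _ _ _ _ (by omega)]
        exact hs i hi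
      · rw [List.getD_append_right _ _ _ _ le_rfl, List.getD_append _ _ _ _ (by omega),
          List.getD_append_right _ _ _ _ (by omega), ← last hl]
        simpa [hl] using ⟨hr, hrw⟩

theorem ReducedHist.of_concat {h : List (SRule T S)} {r : SRule T S}
    (hr : ReducedHist (h ++ [r])) : ReducedHist h := by
  intro i hi
  have := hr i (by simp; omega)
  rwa [List.getD_append _ _ _ _ hi, List.getD_append _ _ _ _ (by omega)] at this

theorem reducedHist_concat_concat_iff {h : List (SRule T S)} {r r' : SRule T S} :
    ReducedHist (h ++ [r] ++ [r']) ↔ ReducedHist (h ++ [r]) ∧ r' ≠ ruleInv r := by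
  constructor
  · intro hr
    refine ⟨hr.of_concat, ?_⟩
    have := hr h.length (by simp)
    rw [List.getD_append_right _ _ _ _ (by simp), List.getD_append _ _ _ _ (by simp)] at this
    simpa using this
  · rintro ⟨hr, hne⟩ i hi
    simp only [List.length_append, List.length_singleton] at hi
    rcases (show i ≤ h.length by omega).lt_or_eq with hi | rfl
    · have := hr i (by simp; omega)
      rwa [List.getD_append _ _ _ _ (by simp; omega),
        List.getD_append (h ++ [r]) _ _ _ (by simp; omega)]
    · rw [List.getD_append_right _ _ _ _ (by simp), List.getD_append _ _ _ _ (by simp)]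
      simpa using hne

end Concat

/-! ### Computations starting at `p₂ δᵏ q₂ δ^ℓ r₂ δᵐ s₂ δⁿ t₂` -/

/-- The word obtained from `p₂ δᵏ q₂ δ^ℓ r₂ δᵐ s₂ δⁿ t₂` by applying rule (1) `j` times. -/
def shifted (k l m n j : ℤ) : GWord Unit St :=
  wform p2 q2 r2 s2 t2 (k + j) (l - j) (m - j) (n + j)

/-- The word obtained from `shifted k l m n j` by applying rule (2) when `ℓ = m = j`. -/
def final (k n j : ℤ) : GWord Unit St := wform p1 q1 r1 s1 t1 (k + j) 0 0 (n + j)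

/-- The computation applying `shift e` to `p₂ δᵏ q₂ δ^ℓ r₂ δᵐ s₂ δⁿ t₂` `N` times. -/
def shiftWords (k l m n : ℤ) (e : Bool) (N : ℕ) : List (GWord Unit St) :=
  (List.range (N + 1)).map fun i : ℕ => shifted k l m n (sgn e * i)

section

variable {k l m n : ℤ}

theorem shifted_zero : shifted k l m n 0 = wform p2 q2 r2 s2 t2 k l m n := by
  simp [shifted]

theorem Wst_eq_shifted (k l m : ℕ) (n : ℤ) : Wst k l m n = shifted k l m n 0 :=
  shifted_zero.symm

theorem shiftWords_succ (e : Bool) (N : ℕ) :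
    shiftWords k l m n e (N + 1) =
      shiftWords k l m n e N ++ [shifted k l m n (sgn e * N + sgn e)] := by
  simp [shiftWords, List.range_succ, mul_add]

theorem lastW_shiftWords (e : Bool) (N : ℕ) :
    lastW (shiftWords k l m n e N) = shifted k l m n (sgn e * N) := by
  simp [shiftWords, List.range_succ, lastW_concat]

theorem shiftWords_zero (e : Bool) : shiftWords k l m n e 0 = [shifted k l m n 0] := by
  simp [shiftWords]

theorem admissible_shifted (j : ℤ) : M2.H.Admissible (shifted k l m n j) :=
  admissible_wform (by simp) (by simp) (by simp) (by simp) (by simp) _ _ _ _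

theorem admissible_final (j : ℤ) : M2.H.Admissible (final k n j) :=
  admissible_wform (by simp) (by simp) (by simp) (by simp) (by simp) _ _ _ _

theorem applyRule_shift_shifted_iff {e : Bool} {j : ℤ} {w : GWord Unit St} :
    ApplyRule (shift e) (shifted k l m n j) w ↔ w = shifted k l m n (j + sgn e) := by
  rw [shifted, applyRule_shift_iff, shifted]
  simp only [add_assoc, sub_sub]

theorem applyRule_rule2_shifted_iff {j : ℤ} {w : GWord Unit St} :
    ApplyRule rule2 (shifted k l m n j) w ↔ l = j ∧ m = j ∧ w = final k n j := by
  rw [shifted, applyRule_rule2_iff, final, sub_eq_zero, sub_eq_zero]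

theorem firstW_concat {T S : Type} {ws : List (GWord T S)} (h : ws ≠ []) (w : GWord T S) :
    firstW (ws ++ [w]) = firstW ws := by
  obtain ⟨v, ws, rfl⟩ := List.exists_cons_of_ne_nil h
  rfl

theorem isComputation_shiftWords (e : Bool) (N : ℕ) :
    IsComputation M2 (shiftWords k l m n e N) (List.replicate N (shift e)) := by
  induction N with
  | zero => exact isComputation_nil_iff.2 ⟨_, shiftWords_zero e, admissible_shifted 0⟩
  | succ N ih =>
    rw [List.replicate_succ', shiftWords_succ]
    refine isComputation_concat_iff.2
      ⟨_, _, rfl, ih, admissible_shifted _, mem_rules.2 (Or.inl ⟨e, rfl⟩), ?_⟩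
    rw [lastW_shiftWords, applyRule_shift_shifted_iff]

theorem firstW_shiftWords (e : Bool) (N : ℕ) :
    firstW (shiftWords k l m n e N) = shifted k l m n 0 := by
  simp [shiftWords, List.range_succ_eq_map, firstW]

theorem reducedHist_replicate_shift (e : Bool) (N : ℕ) :
    ReducedHist (List.replicate N (shift e)) := by
  intro i hi
  rw [List.length_replicate] at hi
  rw [List.getD_replicate _ hi, List.getD_replicate _ (by omega), ruleInv_shift]
  cases e <;> decide

/-- Any computation, reduced or not, ends at a word `shifted` or `final`. -/
theorem lastW_of_isComputation {ws : List (GWord Unit St)} {h : List (SRule Unit St)}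
    (hc : IsComputation M2 ws h) (hw : firstW ws = shifted k l m n 0) :
    (∃ j, lastW ws = shifted k l m n j) ∨ ∃ j, l = j ∧ m = j ∧ lastW ws = final k n j := by
  induction h using List.reverseRecOn generalizing ws with
  | nil =>
    obtain ⟨w, rfl, -⟩ := isComputation_nil_iff.1 hc
    exact Or.inl ⟨0, hw⟩
  | append_singleton h r ih =>
    obtain ⟨ws, w, rfl, hc, -, hr, hrw⟩ := isComputation_concat_iff.1 hc
    rw [firstW_concat hc.1] at hw
    rw [lastW_concat]
    rcases ih hc hw with ⟨j, hj⟩ | ⟨j, rfl, rfl, hj⟩ <;> rw [hj] at hrw <;>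
      rcases mem_rules.1 hr with ⟨e, rfl⟩ | rfl | rfl
    · exact Or.inl ⟨_, applyRule_shift_shifted_iff.1 hrw⟩
    · exact Or.inr ⟨j, applyRule_rule2_shifted_iff.1 hrw⟩
    · exact absurd hrw not_applyRule_ruleInv_rule2
    · exact absurd hrw not_applyRule_shift
    · exact absurd hrw not_applyRule_rule2
    · refine Or.inl ⟨m, ?_⟩
      rw [(applyRule_ruleInv_rule2_iff.1 hrw).2.2, shifted, sub_self]

/-- A reduced computation moves the state letters monotonically, and possibly applies
rule (2) at the end. -/
theorem reduced_computation_cases {ws : List (GWord Unit St)} {h : List (SRule Unit St)}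
    (hc : IsComputation M2 ws h) (hred : ReducedHist h) (hw : firstW ws = shifted k l m n 0) :
    ∃ e N, (h = List.replicate N (shift e) ∧ ws = shiftWords k l m n e N) ∨
      (h = List.replicate N (shift e) ++ [rule2] ∧
        ws = shiftWords k l m n e N ++ [final k n (sgn e * N)] ∧
        l = sgn e * N ∧ m = sgn e * N) := by
  induction h using List.reverseRecOn generalizing ws with
  | nil =>
    obtain ⟨w, rfl, -⟩ := isComputation_nil_iff.1 hc
    exact ⟨true, 0, Or.inl ⟨rfl, by rw [shiftWords_zero, ← hw]; rfl⟩⟩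
  | append_singleton h r ih =>
    obtain ⟨ws, w, rfl, hc, -, hr, hrw⟩ := isComputation_concat_iff.1 hc
    rw [firstW_concat hc.1] at hw
    obtain ⟨e, N, ⟨rfl, rfl⟩ | ⟨rfl, rfl, -, -⟩⟩ := ih hc hred.of_concat hw
    · rw [lastW_shiftWords] at hrw
      rcases mem_rules.1 hr with ⟨e', rfl⟩ | rfl | rfl
      · rw [applyRule_shift_shifted_iff] at hrw
        subst hrw
        refine ⟨e', N + 1, Or.inl ?_⟩
        rw [List.replicate_succ', shiftWords_succ]
        rcases N with _ | N
        · simp [shiftWords_zero]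
        · rw [List.replicate_succ', reducedHist_concat_concat_iff, ruleInv_shift] at hred
          obtain rfl : e' = e := by
            by_contra hne
            exact hred.2 (by rw [Bool.eq_not.2 hne])
          exact ⟨rfl, rfl⟩
      · obtain ⟨hl, hm, rfl⟩ := applyRule_rule2_shifted_iff.1 hrw
        exact ⟨e, N, Or.inr ⟨rfl, rfl, hl, hm⟩⟩
      · exact absurd hrw not_applyRule_ruleInv_rule2
    · rw [lastW_concat] at hrw
      rcases mem_rules.1 hr with ⟨e', rfl⟩ | rfl | rfl
      · exact absurd hrw not_applyRule_shift
      · exact absurd hrw not_applyRule_rule2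
      · exact absurd rfl (reducedHist_concat_concat_iff.1 hred).2

theorem negCount_wform (p q r s t : St) (a b c d : ℤ) :
    negCount () (wform p q r s t a b c d) =
      (-a).toNat + (-b).toNat + (-c).toNat + (-d).toNat := by
  have key (k : ℤ) : negCount () (dpow k) = (-k).toNat := by
    rw [← countP_dpow]
    refine List.countP_congr fun x hx => ?_
    rcases mem_dpow hx with rfl | rfl <;> simp [dl]
  simp only [← key]
  simp [wform, negCount, List.countP_append, st]
  omega

theorem getD_shiftWords {e : Bool} {N i : ℕ} (hi : i ≤ N) :
    (shiftWords k l m n e N).getD i [] = shifted k l m n (sgn e * i) := by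
  rw [List.getD_eq_getElem _ _ (by simp [shiftWords]; omega)]
  simp [shiftWords]

theorem semiproper_of_negCount {ws : List (GWord Unit St)} {e : Bool} {N : ℕ} (hk : 0 ≤ k)
    (hl : 0 ≤ l) (hm : 0 ≤ m) (h : ∀ i < ws.length, negCount () (ws.getD i []) =
      negCount () (shifted k l m n (sgn e * (min i N : ℕ)))) : Semiproper ws := by
  rintro ⟨⟩ i j hij hj
  rw [h i (by omega), h j hj, h 0 (by omega)]
  have : min i N ≤ min j N := by omega
  generalize min i N = i' at *
  generalize min j N = j' at *
  simp only [shifted, negCount_wform, Nat.zero_min, Nat.cast_zero]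
  cases e <;> simp only [sgn] <;> omega

theorem semiproper_of_reducedHist {ws : List (GWord Unit St)} {h : List (SRule Unit St)}
    (hk : 0 ≤ k) (hl : 0 ≤ l) (hm : 0 ≤ m) (hc : IsComputation M2 ws h) (hred : ReducedHist h)
    (hw : firstW ws = shifted k l m n 0) : Semiproper ws := by
  obtain ⟨e, N, ⟨-, rfl⟩ | ⟨-, rfl, h₁, h₂⟩⟩ := reduced_computation_cases hc hred hw <;>
    refine semiproper_of_negCount (n := n) (e := e) (N := N) hk hl hm fun i hi => ?_ <;>
    simp only [shiftWords, List.length_append, List.length_map, List.length_range,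
      List.length_singleton] at hi
  · rw [getD_shiftWords (by omega), min_eq_left (by omega)]
  · rcases (show i ≤ N + 1 by omega).lt_or_eq with hi | rfl
    · rw [List.getD_append _ _ _ _ (by simp [shiftWords]; omega), getD_shiftWords (by omega),
        min_eq_left (by omega)]
    · rw [List.getD_append_right _ _ _ _ (by simp [shiftWords]), min_eq_right (by omega)]
      simp [shiftWords, final, shifted, negCount_wform, ← h₁, h₂]

theorem eq_trivial_of_inCS {ws : List (GWord Unit St)} {h : List (SRule Unit St)}
    (hc : InCS M2 ws h (shifted k l m n 0) [shifted k l m n 0]) :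
    ws = [shifted k l m n 0] ∧ h = [] := by
  obtain ⟨hc, hred, hw, hv⟩ := hc
  have hv := hv _ (List.mem_singleton_self _)
  obtain ⟨e, N, ⟨rfl, rfl⟩ | ⟨-, rfl, -, -⟩⟩ := reduced_computation_cases hc hred hw
  · rw [lastW_shiftWords] at hv
    have := eq_of_wform_infix hv
    obtain rfl : N = 0 := by cases e <;> simp only [sgn] at this <;> omega
    exact ⟨shiftWords_zero e, rfl⟩
  · rw [lastW_concat] at hv
    have : st p2 ∈ final k n (sgn e * N) := hv.subset (by simp [shifted, wform_eq])
    simp [final, wform_eq] at this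

theorem not_st_p1_infix_shifted (j : ℤ) : ¬[st p1] <:+: shifted k l m n j := by
  intro h
  have := h.subset (List.mem_singleton_self _)
  simp [shifted, wform_eq] at this

theorem st_p1_infix_final (j : ℤ) : [st p1] <:+: final k n j := by
  rw [final, wform_eq]
  exact ⟨[], _, rfl⟩

theorem inCS_p1_final (k n : ℤ) (l : ℕ) :
    InCS M2 (shiftWords k l l n true l ++ [final k n l])
      (List.replicate l (shift true) ++ [rule2]) (shifted k l l n 0) [[st p1]] := by
  refine ⟨isComputation_concat_iff.2 ⟨_, _, rfl, isComputation_shiftWords _ _,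
    admissible_final _, mem_rules.2 (by simp), ?_⟩, ?_, ?_, ?_⟩
  · rw [lastW_shiftWords, applyRule_rule2_shifted_iff]
    simp [sgn]
  · rcases l with _ | l
    · intro i hi
      simp at hi
    · rw [List.replicate_succ', reducedHist_concat_concat_iff, ← List.replicate_succ']
      exact ⟨reducedHist_replicate_shift _ _, by decide⟩
  · rw [firstW_concat (by simp [shiftWords]), firstW_shiftWords]
  · simpa [lastW_concat] using st_p1_infix_final _

theorem eq_of_inCS_p1 {l : ℕ} {ws : List (GWord Unit St)} {h : List (SRule Unit St)}
    (hc : InCS M2 ws h (shifted k l l n 0) [[st p1]]) :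
    ws = shiftWords k l l n true l ++ [final k n l] ∧
      h = List.replicate l (shift true) ++ [rule2] := by
  obtain ⟨hc, hred, hw, hv⟩ := hc
  have hv := hv _ (List.mem_singleton_self _)
  obtain ⟨e, N, ⟨-, rfl⟩ | ⟨rfl, rfl, hl, -⟩⟩ := reduced_computation_cases hc hred hw
  · rw [lastW_shiftWords] at hv
    exact absurd hv (not_st_p1_infix_shifted _)
  · rw [← hl]
    cases e
    · simp only [sgn] at hl
      obtain ⟨rfl, rfl⟩ : l = 0 ∧ N = 0 := by omega
      simp [shiftWords_zero]
    · simp only [sgn, one_mul, Nat.cast_inj] at hl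
      subst hl
      exact ⟨rfl, rfl⟩

theorem final_eq_Wone (k l : ℕ) (n : ℤ) : final k n l = Wone k l l n := by
  rw [final, Wone, add_comm n]

end

/-- machine `S₂` moves `q` and `s` toward each other until they meet
at `r`. -/
theorem machine_S2 (k l m : ℕ) (n : ℤ) :
    -- (i) every reduced computation starting at `W` is semiproper
    (∀ ws h, IsComputation M2 ws h → ReducedHist h → firstW ws = Wst k l m n →
      Semiproper ws) ∧
    -- (ii) `CS₂(W, W)` consists of the single trivial computation
    ((∃ ws h, InCS M2 ws h (Wst k l m n) [Wst k l m n]) ∧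
      ∀ ws h, InCS M2 ws h (Wst k l m n) [Wst k l m n] →
        ws = [Wst k l m n] ∧ h = []) ∧
    -- (iii) `S₂(W, p₁)` holds iff `ℓ = m`
    ((∃ ws h, IsComputation M2 ws h ∧ firstW ws = Wst k l m n ∧
        [st p1] <:+: lastW ws) ↔ l = m) ∧
    (l = m →
      (∃ ws h, InCS M2 ws h (Wst k l m n) [[st p1]]) ∧
      (∀ ws h, InCS M2 ws h (Wst k l m n) [[st p1]] → lastW ws = Wone k l m n) ∧
      (∀ ws h ws' h', InCS M2 ws h (Wst k l m n) [[st p1]] →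
        InCS M2 ws' h' (Wst k l m n) [[st p1]] → ws = ws' ∧ h = h')) := by
  refine ⟨fun ws h hc hred hw => ?_, ⟨?_, fun ws h hc => ?_⟩, ⟨?_, ?_⟩, ?_⟩
  · rw [Wst_eq_shifted] at hw
    exact semiproper_of_reducedHist (by omega) (by omega) (by omega) hc hred hw
  · rw [Wst_eq_shifted]
    exact ⟨[_], [], isComputation_nil_iff.2 ⟨_, rfl, admissible_shifted 0⟩, by simp [ReducedHist],
      rfl, by simp [lastW]⟩
  · rw [Wst_eq_shifted] at hc ⊢
    exact eq_trivial_of_inCS hc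
  · rintro ⟨ws, h, hc, hw, hp⟩
    rw [Wst_eq_shifted] at hw
    rcases lastW_of_isComputation hc hw with ⟨j, hj⟩ | ⟨j, hl, hm, -⟩
    · rw [hj] at hp
      exact absurd hp (not_st_p1_infix_shifted _)
    · omega
  · rintro rfl
    obtain ⟨hc, -, hw, hv⟩ := inCS_p1_final k n l
    exact ⟨_, _, hc, hw.trans (Wst_eq_shifted k l l n).symm, hv _ (List.mem_singleton_self _)⟩
  · rintro rfl
    rw [Wst_eq_shifted]
    refine ⟨⟨_, _, inCS_p1_final k n l⟩, fun ws h hc => ?_, fun ws h ws' h' hc hc' => ?_⟩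
    · rw [(eq_of_inCS_p1 hc).1, lastW_concat, final_eq_Wone]
    · obtain ⟨rfl, rfl⟩ := eq_of_inCS_p1 hc
      obtain ⟨rfl, rfl⟩ := eq_of_inCS_p1 hc'
      exact ⟨rfl, rfl⟩
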